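/- arXiv:2012.07032 — 2 statements merged into one kernel-verified Lean document; each statement's English description precedes it below -/
import Mathlib

section
/- Let G be an invertible n×n real matrix whose rows g₁,…,gₙ satisfy G·Gᵀ = Jₙ + Iₙ (the Aₙ basis). For any indices 2 ≤ j < k ≤ n, the unique linear map T : ℝⁿ → ℝⁿ determined by T(g_j) = g_k, T(g_k) = g_j, and T(gᵢ) = gᵢ for i ∉ {j,k} is an orthogonal transformation equal to the reflection y ↦ y − 2·(⟨y, g_j − g_k⟩/‖g_j − g_k‖²)·(g_j − g_k) across the bisector hyperplane {y : ⟨y, g_j − g_k⟩ = 0}; it maps Λ onto Λ, maps P(B) onto P(B), and maps C^b onto C^b for b ∈ {0,1}. Consequently, for every y ∈ ℝⁿ and b ∈ {0,1}, dist(T(y), C^b) = dist(y, C^b), so nearest-corner decoding of the first coordinate is invariant under this folding reflection. -/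
open Matrix Finset

/-- Euclidean norm of a vector in `ℝⁿ`. -/
noncomputable def nrm {n : ℕ} (v : Fin n → ℝ) : ℝ := Real.sqrt (∑ i, v i ^ 2)

/-- The lattice generated by the rows of `G`. -/
def latticePt {n : ℕ} (G : Matrix (Fin n) (Fin n) ℝ) (x : Fin n → ℝ) : Prop :=
  ∃ z : Fin n → ℤ, x = (fun i => (z i : ℝ)) ᵥ* G

/-- The fundamental parallelotope `P(B) = {αG : α ∈ [0,1)ⁿ}`. -/
def fundPar {n : ℕ} (G : Matrix (Fin n) (Fin n) ℝ) : Set (Fin n → ℝ) :=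
  {x | ∃ α : Fin n → ℝ, (∀ i, 0 ≤ α i ∧ α i < 1) ∧ x = α ᵥ* G}

/-- The corner set `C^b = {zG : z ∈ {0,1}ⁿ, z₁ = b}`. -/
def cornerSet {n : ℕ} [NeZero n] (G : Matrix (Fin n) (Fin n) ℝ) (b : ℝ) :
    Set (Fin n → ℝ) :=
  {x | ∃ z : Fin n → ℝ, (∀ i, z i = 0 ∨ z i = 1) ∧ z 0 = b ∧ x = z ᵥ* G}

/-- Euclidean distance from a point to a set. -/
noncomputable def distS {n : ℕ} (y : Fin n → ℝ) (S : Set (Fin n → ℝ)) : ℝ :=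
  sInf ((fun s => nrm (y - s)) '' S)

/-- The reflection of `ℝⁿ` across the hyperplane orthogonal to `v`. -/
noncomputable def hyperplaneReflection {n : ℕ} (v y : Fin n → ℝ) : Fin n → ℝ :=
  y - (2 * ((y ⬝ᵥ v) / (v ⬝ᵥ v))) • v

theorem isLinearMap_hyperplaneReflection {n : ℕ} (v : Fin n → ℝ) :
    IsLinearMap ℝ (hyperplaneReflection v) where
  map_add x y := by
    ext i
    simp only [hyperplaneReflection, add_dotProduct, Pi.sub_apply, Pi.add_apply, Pi.smul_apply,
      smul_eq_mul]
    ring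
  map_smul c x := by
    ext i
    simp only [hyperplaneReflection, smul_dotProduct, Pi.sub_apply, Pi.smul_apply, smul_eq_mul]
    ring

theorem hyperplaneReflection_dotProduct {n : ℕ} {v : Fin n → ℝ} (hv : v ⬝ᵥ v ≠ 0)
    (x y : Fin n → ℝ) :
    hyperplaneReflection v x ⬝ᵥ hyperplaneReflection v y = x ⬝ᵥ y := by
  simp only [hyperplaneReflection, sub_dotProduct, dotProduct_sub, smul_dotProduct,
    dotProduct_smul, smul_eq_mul, dotProduct_comm v y]
  field_simp
  ring

theorem hyperplaneReflection_involutive {n : ℕ} {v : Fin n → ℝ} (hv : v ⬝ᵥ v ≠ 0) :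
    Function.Involutive (hyperplaneReflection v) := by
  intro y
  ext i
  simp only [hyperplaneReflection, sub_dotProduct, smul_dotProduct, Pi.sub_apply, Pi.smul_apply,
    smul_eq_mul]
  field_simp
  ring

theorem nrm_eq_sqrt_dotProduct {n : ℕ} (y : Fin n → ℝ) : nrm y = √(y ⬝ᵥ y) := by
  simp only [nrm, dotProduct, sq]

theorem distS_hyperplaneReflection {n : ℕ} {v : Fin n → ℝ} (hv : v ⬝ᵥ v ≠ 0)
    {S : Set (Fin n → ℝ)} (hS : hyperplaneReflection v '' S = S) (y : Fin n → ℝ) :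
    distS (hyperplaneReflection v y) S = distS y S := by
  have h (s : Fin n → ℝ) :
      nrm (hyperplaneReflection v y - hyperplaneReflection v s) = nrm (y - s) := by
    rw [← (isLinearMap_hyperplaneReflection v).map_sub, nrm_eq_sqrt_dotProduct,
      hyperplaneReflection_dotProduct hv, ← nrm_eq_sqrt_dotProduct]
  unfold distS
  conv_lhs => rw [← hS, Set.image_image]
  simp only [h]

theorem image_eq_of_involutive_of_mapsTo {α : Type*} {f : α → α} (hf : Function.Involutive f)
    {S : Set α} (h : Set.MapsTo f S S) : f '' S = S :=
  h.image_subset.antisymm fun x hx => ⟨f x, h hx, hf x⟩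

section Gram

variable {n : ℕ} {G : Matrix (Fin n) (Fin n) ℝ}

theorem row_dotProduct_row (hGram : G * G.transpose = Matrix.of (fun _ _ => (1 : ℝ)) + 1)
    (i l : Fin n) : G i ⬝ᵥ G l = 1 + if i = l then 1 else 0 := by
  have h := congrFun (congrFun hGram i) l
  rwa [Matrix.mul_apply', Matrix.add_apply, Matrix.of_apply, Matrix.one_apply] at h

theorem row_sub_row_dotProduct_self
    (hGram : G * G.transpose = Matrix.of (fun _ _ => (1 : ℝ)) + 1) {j k : Fin n} (hjk : j ≠ k) :
    (G j - G k) ⬝ᵥ (G j - G k) = 2 := by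
  simp only [sub_dotProduct, dotProduct_sub, row_dotProduct_row hGram, if_neg hjk,
    if_neg hjk.symm, if_true]
  norm_num

theorem vecMul_dotProduct_row_sub_row
    (hGram : G * G.transpose = Matrix.of (fun _ _ => (1 : ℝ)) + 1) (j k : Fin n)
    (z : Fin n → ℝ) : (z ᵥ* G) ⬝ᵥ (G j - G k) = z j - z k := by
  have h : G *ᵥ (G j - G k) = Pi.single j 1 - Pi.single k 1 := by
    ext i
    change G i ⬝ᵥ (G j - G k) = _
    simp [dotProduct_sub, row_dotProduct_row hGram, Pi.single_apply]
  rw [← dotProduct_mulVec, h, dotProduct_sub, dotProduct_single_one, dotProduct_single_one]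

/-- In coordinates with respect to the rows of `G`, the reflection swaps two entries. -/
theorem hyperplaneReflection_vecMul
    (hGram : G * G.transpose = Matrix.of (fun _ _ => (1 : ℝ)) + 1) {j k : Fin n} (hjk : j ≠ k)
    (z : Fin n → ℝ) :
    hyperplaneReflection (G j - G k) (z ᵥ* G) = (z ∘ Equiv.swap j k) ᵥ* G := by
  have h : z ∘ Equiv.swap j k = z - (z j - z k) • (Pi.single j 1 - Pi.single k 1) := by
    ext i
    rcases eq_or_ne i j with rfl | hij
    · simp [hjk]
    rcases eq_or_ne i k with rfl | hik
    · simp [hjk.symm]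
    · simp [Equiv.swap_apply_of_ne_of_ne hij hik, hij, hik]
  rw [hyperplaneReflection, vecMul_dotProduct_row_sub_row hGram,
    row_sub_row_dotProduct_self hGram hjk, h, sub_vecMul, smul_vecMul, sub_vecMul,
    single_one_vecMul, single_one_vecMul, mul_div_cancel₀ _ two_ne_zero]
  rfl

theorem hyperplaneReflection_row
    (hGram : G * G.transpose = Matrix.of (fun _ _ => (1 : ℝ)) + 1) {j k : Fin n} (hjk : j ≠ k)
    (i : Fin n) : hyperplaneReflection (G j - G k) (G i) = G (Equiv.swap j k i) := by
  have h : (Pi.single i 1 : Fin n → ℝ) ∘ Equiv.swap j k = Pi.single (Equiv.swap j k i) 1 := by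
    ext l
    simp [Pi.single_apply, Equiv.swap_apply_eq_iff]
  have hrow (l : Fin n) : G l = Pi.single l 1 ᵥ* G := (single_one_vecMul l G).symm
  rw [hrow i, hyperplaneReflection_vecMul hGram hjk, h, ← hrow]

end Gram

/-- for the `Aₙ` basis (Gram matrix `Jₙ + Iₙ`) and `2 ≤ j < k ≤ n`, the
reflection across the bisector hyperplane of `g_j, g_k` is the unique linear map swapping
`g_j` and `g_k` and fixing the other basis vectors; it is orthogonal, preserves `Λ`,
`P(B)` and the corner sets `C^b`, and hence preserves the distances to `C^b`. -/
theorem An_folding_reflection (n : ℕ) [NeZero n]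
    (G : Matrix (Fin n) (Fin n) ℝ) (hG : IsUnit G.det)
    (hGram : G * G.transpose = Matrix.of (fun _ _ => (1 : ℝ)) + 1)
    (j k : Fin n) (hj : 1 ≤ (j : ℕ)) (hjk : j < k) :
    let v : Fin n → ℝ := G j - G k
    let T : (Fin n → ℝ) → (Fin n → ℝ) :=
      fun y => y - (2 * ((∑ i, y i * v i) / (∑ i, v i * v i))) • v
    (T (G j) = G k ∧ T (G k) = G j ∧ ∀ i : Fin n, i ≠ j → i ≠ k → T (G i) = G i) ∧
    IsLinearMap ℝ T ∧
    (∀ y y' : Fin n → ℝ, ∑ i, T y i * T y' i = ∑ i, y i * y' i) ∧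
    T '' {x | latticePt G x} = {x | latticePt G x} ∧
    T '' fundPar G = fundPar G ∧
    (∀ b : ℝ, b = 0 ∨ b = 1 → T '' cornerSet G b = cornerSet G b) ∧
    (∀ y : Fin n → ℝ, ∀ b : ℝ, b = 0 ∨ b = 1 →
      distS (T y) (cornerSet G b) = distS y (cornerSet G b)) := by
  intro v T
  have hne : j ≠ k := hjk.ne
  have hv : v ⬝ᵥ v ≠ 0 := by
    rw [row_sub_row_dotProduct_self hGram hne]
    exact two_ne_zero
  have hT : T = hyperplaneReflection v := rfl
  have hinv := hyperplaneReflection_involutive hv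
  have hcorner (b : ℝ) : hyperplaneReflection v '' cornerSet G b = cornerSet G b := by
    refine image_eq_of_involutive_of_mapsTo hinv ?_
    rintro _ ⟨z, hz, hz0, rfl⟩
    refine ⟨z ∘ Equiv.swap j k, fun i => hz _, ?_, hyperplaneReflection_vecMul hGram hne z⟩
    have h0j : (0 : Fin n) ≠ j := by
      rintro rfl
      simp at hj
    have h0k : (0 : Fin n) ≠ k := by
      rintro rfl
      exact absurd hjk (by simp)
    rw [Function.comp_apply, Equiv.swap_apply_of_ne_of_ne h0j h0k, hz0]
  rw [hT]
  refine ⟨⟨?_, ?_, fun i hij hik => ?_⟩, isLinearMap_hyperplaneReflection v,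
    hyperplaneReflection_dotProduct hv, image_eq_of_involutive_of_mapsTo hinv ?_,
    image_eq_of_involutive_of_mapsTo hinv ?_, fun b _ => hcorner b,
    fun y b _ => distS_hyperplaneReflection hv (hcorner b) y⟩
  · rw [hyperplaneReflection_row hGram hne, Equiv.swap_apply_left]
  · rw [hyperplaneReflection_row hGram hne, Equiv.swap_apply_right]
  · rw [hyperplaneReflection_row hGram hne, Equiv.swap_apply_of_ne_of_ne hij hik]
  · rintro _ ⟨z, rfl⟩
    exact ⟨z ∘ Equiv.swap j k, hyperplaneReflection_vecMul hGram hne _⟩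
  · rintro _ ⟨α, hα, rfl⟩
    exact ⟨α ∘ Equiv.swap j k, fun i => hα _, hyperplaneReflection_vecMul hGram hne α⟩
end

section
/- Let G be an invertible n×n real matrix whose rows g₁,…,gₙ satisfy G·Gᵀ = Jₙ + Iₙ (the Aₙ basis). For each 1 ≤ i ≤ n, the number of corners x ∈ C¹ with |T_f(x) ∩ C⁰| = i equals the binomial coefficient C(n−1, n−i). Consequently, the total number of pairs (x, x') with x ∈ C¹ and x' ∈ T_f(x) ∩ C⁰ — each such pair contributing one affine piece of the decision boundary function — equals Σ_{i=1}^{n} i·C(n−1, n−i), which is exponential in n. -/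
open Matrix Finset

/-- The Voronoi region of `x` in the lattice generated by `G`. -/
def Vor {n : ℕ} (G : Matrix (Fin n) (Fin n) ℝ) (x : Fin n → ℝ) : Set (Fin n → ℝ) :=
  {y | ∀ lam : Fin n → ℝ, latticePt G lam → nrm (y - x) ≤ nrm (y - lam)}

/-- `x'` shares an `(n−1)`-dimensional Voronoi facet with `x`. -/
def sharesFacet {n : ℕ} (G : Matrix (Fin n) (Fin n) ℝ) (x x' : Fin n → ℝ) : Prop :=
  Module.finrank ℝ (affineSpan ℝ (Vor G x ∩ Vor G x')).direction = n - 1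

section AnLattice

variable {n : ℕ}

/-- The inclusion of `ℤⁿ` as the lattice generated by the rows of `G`. -/
noncomputable def latticeHom (G : Matrix (Fin n) (Fin n) ℝ) : (Fin n → ℤ) →+ (Fin n → ℝ) where
  toFun z := (fun i => (z i : ℝ)) ᵥ* G
  map_zero' := by
    ext i
    simp [vecMul, dotProduct]
  map_add' z w := by
    rw [← add_vecMul]
    congr 1
    ext i
    simp

lemma latticeHom_apply (G : Matrix (Fin n) (Fin n) ℝ) (z : Fin n → ℤ) :
    latticeHom G z = (fun i => (z i : ℝ)) ᵥ* G := rfl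

/-- The integral bilinear form with Gram matrix `Jₙ + Iₙ`. -/
def rootForm (z w : Fin n → ℤ) : ℤ := (∑ i, z i) * (∑ i, w i) + ∑ i, z i * w i

lemma two_dvd_rootForm_self (z : Fin n → ℤ) : 2 ∣ rootForm z z := by
  have h : rootForm z z = (∑ i, z i) * (∑ i, z i + 1) + ∑ i, z i * (z i - 1) := by
    simp only [rootForm, mul_sub, mul_add, mul_one, Finset.sum_sub_distrib]
    ring
  rw [h]
  refine dvd_add (Int.even_mul_succ_self _).two_dvd (Finset.dvd_sum fun i _ => ?_)
  exact (Int.even_mul_pred_self _).two_dvd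

lemma two_le_rootForm_self {z : Fin n → ℤ} (hz : z ≠ 0) : 2 ≤ rootForm z z := by
  obtain ⟨i, hi⟩ := Function.ne_iff.mp hz
  have hpos : 0 < ∑ i, z i * z i :=
    Finset.sum_pos' (fun i _ => mul_self_nonneg _) ⟨i, Finset.mem_univ i, mul_self_pos.mpr hi⟩
  have h : 0 < rootForm z z := add_pos_of_nonneg_of_pos (mul_self_nonneg _) hpos
  have := two_dvd_rootForm_self z
  omega

lemma rootForm_comm (z w : Fin n → ℤ) : rootForm z w = rootForm w z := by
  simp only [rootForm, mul_comm]

lemma rootForm_single (i : Fin n) (z : Fin n → ℤ) :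
    rootForm (Pi.single i 1) z = ∑ k, z k + z i := by
  simp [rootForm, Pi.single_apply]

lemma rootForm_sub_left (z z' w : Fin n → ℤ) :
    rootForm (z - z') w = rootForm z w - rootForm z' w := by
  simp only [rootForm, Pi.sub_apply, sub_mul, Finset.sum_sub_distrib]
  ring

variable {G : Matrix (Fin n) (Fin n) ℝ}

lemma latticeHom_dotProduct
    (hGram : G * G.transpose = Matrix.of (fun _ _ => (1 : ℝ)) + 1) (z w : Fin n → ℤ) :
    latticeHom G z ⬝ᵥ latticeHom G w = rootForm z w := by
  rw [latticeHom_apply, latticeHom_apply, ← mulVec_transpose G (fun i => (w i : ℝ)),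
    dotProduct_mulVec, vecMul_vecMul, hGram, vecMul_add, vecMul_one, add_dotProduct]
  simp [rootForm, vecMul, dotProduct, Finset.mul_sum]

lemma latticeHom_injective (hG : IsUnit G.det) : Function.Injective (latticeHom G) := by
  intro z w h
  have := (vecMul_injective_iff_isUnit.mpr ((isUnit_iff_isUnit_det G).mpr hG)) h
  ext i
  exact_mod_cast congrFun this i

lemma nrm_le_nrm_iff (v w : Fin n → ℝ) : nrm v ≤ nrm w ↔ v ⬝ᵥ v ≤ w ⬝ᵥ w := by
  simp only [nrm, dotProduct, ← pow_two]
  exact Real.sqrt_le_sqrt_iff (Finset.sum_nonneg fun i _ => sq_nonneg _)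

lemma mem_Vor_latticeHom_iff (a : Fin n → ℤ) (y : Fin n → ℝ) :
    y ∈ Vor G (latticeHom G a) ↔
      ∀ v, 0 ≤ 2 * ((y - latticeHom G a) ⬝ᵥ latticeHom G v)
        + latticeHom G v ⬝ᵥ latticeHom G v := by
  have key (v : Fin n → ℤ) : nrm (y - latticeHom G a) ≤ nrm (y - latticeHom G (a - v)) ↔
      0 ≤ 2 * ((y - latticeHom G a) ⬝ᵥ latticeHom G v)
        + latticeHom G v ⬝ᵥ latticeHom G v := by
    rw [nrm_le_nrm_iff, map_sub, ← sub_add, add_dotProduct, dotProduct_add, dotProduct_add,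
      dotProduct_comm (latticeHom G v) (y - _)]
    constructor <;> intro h <;> linarith
  constructor
  · exact fun h v => (key v).mp (h _ ⟨a - v, rfl⟩)
  · rintro h _ ⟨z, rfl⟩
    simpa [latticeHom_apply] using (key (a - z)).mpr (h _)

lemma mem_ker_dotProductEquiv {u v : Fin n → ℝ} :
    u ∈ LinearMap.ker (dotProductEquiv ℝ (Fin n) v) ↔ u ⬝ᵥ v = 0 := by
  rw [LinearMap.mem_ker, dotProductEquiv_apply_apply, dotProduct_comm]

lemma finrank_ker_dotProductEquiv {v : Fin n → ℝ} (hv : v ≠ 0) :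
    Module.finrank ℝ (LinearMap.ker (dotProductEquiv ℝ (Fin n) v)) = n - 1 := by
  have h : dotProductEquiv ℝ (Fin n) v ≠ 0 := (map_ne_zero_iff _ (LinearEquiv.injective _)).mpr hv
  have := Module.Dual.finrank_ker_add_one_of_ne_zero h
  rw [Module.finrank_fin_fun] at this
  omega

/-- If `v` is a lattice vector with `‖v‖² ≤ ⟨v, a - b⟩`, then the intersection of the Voronoi
regions of `a` and `b` lies in a hyperplane orthogonal to `v`. -/
lemma direction_le_ker_dotProductEquiv (a b v : Fin n → ℤ)
    (hv : latticeHom G v ⬝ᵥ latticeHom G v ≤ latticeHom G (a - b) ⬝ᵥ latticeHom G v) :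
    (affineSpan ℝ (Vor G (latticeHom G a) ∩ Vor G (latticeHom G b))).direction
      ≤ LinearMap.ker (dotProductEquiv ℝ (Fin n) (latticeHom G v)) := by
  rw [direction_affineSpan, vectorSpan, Submodule.span_le]
  have key (y) (hy : y ∈ Vor G (latticeHom G a) ∩ Vor G (latticeHom G b)) :
      2 * (y ⬝ᵥ latticeHom G v) =
        2 * (latticeHom G b ⬝ᵥ latticeHom G v) + latticeHom G v ⬝ᵥ latticeHom G v := by
    have h1 := (mem_Vor_latticeHom_iff a y).mp hy.1 v
    have h2 := (mem_Vor_latticeHom_iff b y).mp hy.2 (-v)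
    simp only [map_sub, map_neg, sub_dotProduct, dotProduct_neg, neg_dotProduct, neg_neg]
      at h1 h2 hv
    linarith
  rintro _ ⟨y, hy, y', hy', rfl⟩
  have h1 := key y hy
  have h2 := key y' hy'
  simp only [SetLike.mem_coe, mem_ker_dotProductEquiv, vsub_eq_sub, sub_dotProduct]
  linarith

/-- Small translates, orthogonal to a minimal vector `d`, of the midpoint of `0` and `d` are at
least as close to `d` as to any other lattice point. -/
lemma midpoint_add_closest
    (hGram : G * G.transpose = Matrix.of (fun _ _ => (1 : ℝ)) + 1) {d : Fin n → ℤ}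
    (hd : rootForm d d = 2) {u : Fin n → ℝ} (hu : u ⬝ᵥ latticeHom G d = 0)
    (hu' : u ⬝ᵥ u ≤ 1 / 8) (v : Fin n → ℤ) :
    0 ≤ 2 * (u ⬝ᵥ latticeHom G v) - latticeHom G d ⬝ᵥ latticeHom G v
      + latticeHom G v ⬝ᵥ latticeHom G v := by
  rcases eq_or_ne v 0 with rfl | hv
  · simp
  rcases eq_or_ne v d with rfl | hvd
  · simp [hu]
  have h1 : (2 : ℝ) ≤ latticeHom G v ⬝ᵥ latticeHom G v := by
    rw [latticeHom_dotProduct hGram]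
    exact_mod_cast two_le_rootForm_self hv
  have h2 : (2 : ℝ) ≤ latticeHom G (v - d) ⬝ᵥ latticeHom G (v - d) := by
    rw [latticeHom_dotProduct hGram]
    exact_mod_cast two_le_rootForm_self (sub_ne_zero.mpr hvd)
  have h3 : latticeHom G d ⬝ᵥ latticeHom G d = 2 := by
    rw [latticeHom_dotProduct hGram, hd]
    norm_num
  have h4 := dotProduct_self_star_nonneg ((4 : ℝ) • u + latticeHom G v)
  simp only [map_sub, star_trivial, sub_dotProduct, dotProduct_sub, add_dotProduct,
    dotProduct_add, smul_dotProduct, dotProduct_smul, smul_eq_mul] at h2 h4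
  rw [dotProduct_comm (latticeHom G v) u] at h4
  rw [dotProduct_comm (latticeHom G v) (latticeHom G d)] at h2
  linarith

lemma ker_dotProductEquiv_le_direction
    (hGram : G * G.transpose = Matrix.of (fun _ _ => (1 : ℝ)) + 1) {a b : Fin n → ℤ}
    (hd : rootForm (a - b) (a - b) = 2) :
    LinearMap.ker (dotProductEquiv ℝ (Fin n) (latticeHom G (a - b)))
      ≤ (affineSpan ℝ (Vor G (latticeHom G a) ∩ Vor G (latticeHom G b))).direction := by
  set d := latticeHom G (a - b) with hd_def
  have key (u : Fin n → ℝ) (hu : u ⬝ᵥ d = 0) (hu' : u ⬝ᵥ u ≤ 1 / 8) :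
      u + (latticeHom G a - (1 / 2 : ℝ) • d) ∈
        Vor G (latticeHom G a) ∩ Vor G (latticeHom G b) := by
    constructor
    · rw [mem_Vor_latticeHom_iff]
      intro v
      have h := midpoint_add_closest hGram hd hu hu' v
      rw [← hd_def] at h
      have e : u + (latticeHom G a - (1 / 2 : ℝ) • d) - latticeHom G a
          = u - (1 / 2 : ℝ) • d := by abel
      rw [e, sub_dotProduct, smul_dotProduct, smul_eq_mul]
      linarith
    · rw [mem_Vor_latticeHom_iff]
      intro v
      have h := midpoint_add_closest hGram hd (u := -u) (by rw [neg_dotProduct, hu, neg_zero])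
        (by simpa using hu') (-v)
      rw [← hd_def] at h
      have e : u + (latticeHom G a - (1 / 2 : ℝ) • d) - latticeHom G b
          = u + (1 / 2 : ℝ) • d := by
        rw [hd_def, map_sub]
        module
      rw [e, add_dotProduct, smul_dotProduct, smul_eq_mul]
      simp only [map_neg, neg_dotProduct, dotProduct_neg, neg_neg] at h
      linarith
  intro u hu
  rw [mem_ker_dotProductEquiv] at hu
  have hq : 0 ≤ u ⬝ᵥ u := by simpa using dotProduct_self_star_nonneg u
  obtain ⟨t, ht, htu⟩ : ∃ t : ℝ, 0 < t ∧ t * (t * (u ⬝ᵥ u)) ≤ 1 / 8 := by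
    refine ⟨1 / (8 * (1 + u ⬝ᵥ u)), by positivity, ?_⟩
    rw [← mul_assoc, div_mul_div_comm, div_mul_eq_mul_div, div_le_div_iff₀ (by positivity)
      (by norm_num)]
    nlinarith
  have h := vsub_mem_vectorSpan ℝ
    (key (t • u) (by rw [smul_dotProduct, hu, smul_zero])
      (by simpa [smul_dotProduct, dotProduct_smul] using htu))
    (key 0 (by simp) (by simp))
  rw [direction_affineSpan]
  simpa [smul_smul, ht.ne'] using Submodule.smul_mem _ t⁻¹ h

lemma sharesFacet_of_rootForm_eq_two (hG : IsUnit G.det)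
    (hGram : G * G.transpose = Matrix.of (fun _ _ => (1 : ℝ)) + 1) {a b : Fin n → ℤ}
    (hd : rootForm (a - b) (a - b) = 2) :
    sharesFacet G (latticeHom G a) (latticeHom G b) := by
  have hne : latticeHom G (a - b) ≠ 0 := by
    rw [(map_ne_zero_iff _ (latticeHom_injective hG))]
    intro h
    rw [h] at hd
    simp [rootForm] at hd
  rw [sharesFacet, ← finrank_ker_dotProductEquiv hne,
    le_antisymm (direction_le_ker_dotProductEquiv a b _ le_rfl)
      (ker_dotProductEquiv_le_direction hGram hd)]

/-- If `d = a - b` and `v` are distinct and have the same nonzero first coordinate, then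
`v` witnesses that `a` and `b` do not share a facet as soon as `‖v‖² ≤ ⟨v, d⟩`. -/
lemma eq_of_sharesFacet [NeZero n] (hG : IsUnit G.det) {a b v : Fin n → ℤ}
    (hab : sharesFacet G (latticeHom G a) (latticeHom G b))
    (hv : latticeHom G v ⬝ᵥ latticeHom G v ≤ latticeHom G (a - b) ⬝ᵥ latticeHom G v)
    (h0 : v 0 = (a - b) 0) (hv0 : v 0 ≠ 0) : a - b = v := by
  set d := a - b with hd
  have hdne : latticeHom G d ≠ 0 := by
    rw [(map_ne_zero_iff _ (latticeHom_injective hG))]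
    rintro h
    exact hv0 (by rw [h0, h, Pi.zero_apply])
  have hqd : latticeHom G d ⬝ᵥ latticeHom G d ≠ 0 := mt dotProduct_self_eq_zero.mp hdne
  have h1 := direction_le_ker_dotProductEquiv a b _ hv
  have h2 := direction_le_ker_dotProductEquiv (G := G) a b d le_rfl
  have heq := Submodule.eq_of_le_of_finrank_eq h2 
    (hab.trans (finrank_ker_dotProductEquiv hdne).symm)
  rw [heq] at h1
  set c := (latticeHom G v ⬝ᵥ latticeHom G d) / (latticeHom G d ⬝ᵥ latticeHom G d) with hc
  have hu : (latticeHom G v - c • latticeHom G d) ⬝ᵥ latticeHom G d = 0 := by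
    rw [sub_dotProduct, smul_dotProduct, smul_eq_mul, hc, div_mul_cancel₀ _ hqd, sub_self]
  have hu' : (latticeHom G v - c • latticeHom G d) ⬝ᵥ latticeHom G v = 0 :=
    mem_ker_dotProductEquiv.mp (h1 (mem_ker_dotProductEquiv.mpr hu))
  have hzero : latticeHom G v - c • latticeHom G d = 0 := by
    rw [← dotProduct_self_eq_zero, dotProduct_sub, hu', dotProduct_smul, hu, smul_zero, sub_zero]
  have hvec : (fun i => (v i : ℝ)) = c • fun i => (d i : ℝ) := by
    apply vecMul_injective_iff_isUnit.mpr ((isUnit_iff_isUnit_det G).mpr hG)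
    simpa only [smul_vecMul, latticeHom_apply] using sub_eq_zero.mp hzero
  have hc1 : c = 1 := by
    have := congrFun hvec 0
    simp only [Pi.smul_apply, smul_eq_mul, ← h0] at this
    exact (right_eq_mul₀ (Int.cast_ne_zero.mpr hv0)).mp this
  ext i
  have := congrFun hvec i
  simp only [hc1, one_smul] at this
  exact_mod_cast this.symm

lemma sharesFacet_iff [NeZero n] (hG : IsUnit G.det)
    (hGram : G * G.transpose = Matrix.of (fun _ _ => (1 : ℝ)) + 1) {a b : Fin n → ℤ}
    (h0 : (a - b) 0 = 1) :
    sharesFacet G (latticeHom G a) (latticeHom G b) ↔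
      a - b = Pi.single 0 1 ∨ ∃ j ≠ 0, a - b = Pi.single 0 1 - Pi.single j 1 := by
  have hroot (j : Fin n) (hj : j ≠ 0) (w : Fin n → ℤ) :
      rootForm (Pi.single 0 1 - Pi.single j 1) w = w 0 - w j := by
    rw [rootForm_sub_left, rootForm_single, rootForm_single]
    ring
  constructor
  · intro h
    by_cases hS : 0 < ∑ k, (a - b) k
    · left
      refine eq_of_sharesFacet hG h ?_ (by simp [h0]) (by simp)
      rw [latticeHom_dotProduct hGram, latticeHom_dotProduct hGram, rootForm_comm (a - b),
        rootForm_single, rootForm_single, h0]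
      simp only [Finset.sum_pi_single', Pi.single_eq_same, Finset.mem_univ, if_true]
      exact_mod_cast (by omega)
    · right
      obtain ⟨j, hj⟩ : ∃ j, (a - b) j < 0 := by
        by_contra! hpos
        have := Finset.single_le_sum (fun i _ => hpos i) (Finset.mem_univ (0 : Fin n))
        omega
      have hj0 : j ≠ 0 := by
        rintro rfl
        omega
      refine ⟨j, hj0, eq_of_sharesFacet hG h ?_ (by simp [h0, hj0.symm]) (by simp [hj0.symm])⟩
      rw [latticeHom_dotProduct hGram, latticeHom_dotProduct hGram, rootForm_comm (a - b),
        hroot j hj0, hroot j hj0, h0]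
      have e0 : (Pi.single 0 1 - Pi.single j 1 : Fin n → ℤ) 0 = 1 := by simp [hj0.symm]
      have ej : (Pi.single 0 1 - Pi.single j 1 : Fin n → ℤ) j = -1 := by simp [hj0]
      rw [e0, ej, Int.cast_le]
      omega
  · intro h
    apply sharesFacet_of_rootForm_eq_two hG hGram
    rcases h with h | ⟨j, hj, h⟩ <;> rw [h]
    · rw [rootForm_single]
      simp
    · rw [hroot j hj]
      simp [hj, hj.symm]

/-- The `0/1` vector of a set of coordinates. -/
def cornerVec (s : Finset (Fin n)) : Fin n → ℤ := fun i => if i ∈ s then 1 else 0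

lemma cornerVec_injective : Function.Injective (cornerVec (n := n)) := by
  intro s t h
  ext i
  have := congrFun h i
  simp only [cornerVec] at this
  grind

section Corners

variable [NeZero n]

lemma cornerSet_eq_image (G : Matrix (Fin n) (Fin n) ℝ) (b : ℝ) :
    cornerSet G b = (fun s => latticeHom G (cornerVec s)) '' {s | (cornerVec s 0 : ℝ) = b} := by
  ext x
  constructor
  · rintro ⟨z, hz, h0, rfl⟩
    have hz' : (fun i => (cornerVec {i | z i = 1} i : ℝ)) = z := by
      ext i
      rcases hz i with h | h <;> simp [cornerVec, h]
    refine ⟨({i | z i = 1} : Finset (Fin n)), (congrFun hz' 0).trans h0, ?_⟩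
    simp only [latticeHom_apply, hz']
  · rintro ⟨s, hs, rfl⟩
    refine ⟨fun i => (cornerVec s i : ℝ), fun i => ?_, hs, rfl⟩
    by_cases h : i ∈ s <;> simp [cornerVec, h]

lemma cornerSet_one (G : Matrix (Fin n) (Fin n) ℝ) :
    cornerSet G 1 = (fun s => latticeHom G (cornerVec s)) '' {s | 0 ∈ s} := by
  rw [cornerSet_eq_image]
  congr! 3 with s
  simp [cornerVec]

lemma cornerSet_zero (G : Matrix (Fin n) (Fin n) ℝ) :
    cornerSet G 0 = (fun s => latticeHom G (cornerVec s)) '' {s | 0 ∉ s} := by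
  rw [cornerSet_eq_image]
  congr! 3 with s
  simp [cornerVec]

/-- The supports of the corners in `C⁰` sharing a facet with the corner of support `s`. -/
def facetNeighbors (s : Finset (Fin n)) : Finset (Finset (Fin n)) :=
  insert (s.erase 0) (sᶜ.image fun j => insert j (s.erase 0))

lemma card_facetNeighbors (s : Finset (Fin n)) : #(facetNeighbors s) = #sᶜ + 1 := by
  rw [facetNeighbors, Finset.card_insert_of_notMem, Finset.card_image_of_injOn]
  · intro i hi j hj hij
    simp only [Finset.coe_compl, Set.mem_compl_iff, Finset.mem_coe] at hi hj
    have : i ∈ insert j (s.erase 0) := by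
      rw [← show insert i (s.erase 0) = insert j (s.erase 0) from hij]
      exact Finset.mem_insert_self i _
    grind
  · simp only [Finset.mem_image, Finset.mem_compl, not_exists, not_and]
    intro j hj h
    have : j ∈ s.erase 0 := h ▸ Finset.mem_insert_self j _
    exact hj (Finset.mem_of_mem_erase this)

lemma cornerVec_sub_eq_single_iff {s t : Finset (Fin n)} (hs : 0 ∈ s) :
    cornerVec s - cornerVec t = Pi.single 0 1 ↔ t = s.erase 0 := by
  rw [funext_iff, Finset.ext_iff]
  refine forall_congr' fun i => ?_
  simp only [Pi.sub_apply, cornerVec, Pi.single_apply, Finset.mem_erase]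
  grind

lemma cornerVec_sub_eq_single_sub_single_iff {s t : Finset (Fin n)} (hs : 0 ∈ s)
    (ht : 0 ∉ t) {j : Fin n} (hj : j ≠ 0) :
    cornerVec s - cornerVec t = Pi.single 0 1 - Pi.single j 1 ↔
      j ∉ s ∧ insert j (s.erase 0) = t := by
  simp only [funext_iff, Finset.ext_iff, Pi.sub_apply, cornerVec, Pi.single_apply,
    Finset.mem_erase, Finset.mem_insert]
  constructor
  · intro h
    have := h j
    exact ⟨by grind, fun i => by have := h i; grind⟩
  · rintro ⟨h, h'⟩ i
    have := h' i
    grind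

lemma sharesFacet_cornerVec_iff (hG : IsUnit G.det)
    (hGram : G * G.transpose = Matrix.of (fun _ _ => (1 : ℝ)) + 1) {s t : Finset (Fin n)}
    (hs : 0 ∈ s) :
    0 ∉ t ∧ sharesFacet G (latticeHom G (cornerVec s)) (latticeHom G (cornerVec t)) ↔
      t ∈ facetNeighbors s := by
  have h0 : t ∈ facetNeighbors s → 0 ∉ t := by
    simp only [facetNeighbors, Finset.mem_insert, Finset.mem_image, Finset.mem_compl]
    grind
  rw [← and_iff_right_of_imp h0]
  refine and_congr_right fun ht => ?_
  rw [sharesFacet_iff hG hGram (by simp [cornerVec, hs, ht]), cornerVec_sub_eq_single_iff hs,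
    facetNeighbors, Finset.mem_insert, Finset.mem_image]
  refine or_congr_right (exists_congr fun j => ?_)
  rw [Finset.mem_compl]
  constructor
  · rintro ⟨hj, h⟩
    exact (cornerVec_sub_eq_single_sub_single_iff hs ht hj).mp h
  · rintro ⟨hj, h⟩
    have hj0 : j ≠ 0 := fun h => hj (h ▸ hs)
    exact ⟨hj0, (cornerVec_sub_eq_single_sub_single_iff hs ht hj0).mpr ⟨hj, h⟩⟩

lemma card_filter_card_facetNeighbors {i : ℕ} (hi : 1 ≤ i) (hin : i ≤ n) :
    #{s : Finset (Fin n) | 0 ∈ s ∧ #(facetNeighbors s) = i} = Nat.choose (n - 1) (n - i) := by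
  have hcard : #((Finset.univ : Finset (Fin n)).erase 0) = n - 1 := by
    rw [Finset.card_erase_of_mem (Finset.mem_univ _), Finset.card_univ, Fintype.card_fin]
  rw [← hcard, ← Finset.card_powersetCard]
  refine Finset.card_nbij' (fun s => s.erase 0) (fun s => insert 0 s) ?_ ?_ ?_ ?_
  · intro s hs
    simp only [Finset.coe_filter, Finset.mem_univ, true_and, Set.mem_ofPred_eq] at hs
    obtain ⟨h0, hs⟩ := hs
    rw [card_facetNeighbors, Finset.card_compl, Fintype.card_fin] at hs
    have := Finset.card_le_univ s
    rw [Fintype.card_fin] at this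
    simp only [Finset.mem_coe, Finset.mem_powersetCard]
    refine ⟨Finset.erase_subset_erase _ (Finset.subset_univ s), ?_⟩
    rw [Finset.card_erase_of_mem h0]
    omega
  · intro s hs
    simp only [Finset.mem_coe, Finset.mem_powersetCard] at hs
    have h0 : 0 ∉ s := fun h => Finset.notMem_erase _ _ (hs.1 h)
    have h0' : (0 : Fin n) ∈ insert 0 s := Finset.mem_insert_self _ _
    simp only [Finset.coe_filter, Finset.mem_univ, true_and, Set.mem_ofPred_eq]
    refine ⟨h0', ?_⟩
    rw [card_facetNeighbors, Finset.card_compl, Fintype.card_fin,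
      Finset.card_insert_of_notMem h0]
    omega
  · intro s hs
    simp only [Finset.coe_filter, Finset.mem_univ, true_and, Set.mem_ofPred_eq] at hs
    exact Finset.insert_erase hs.1
  · intro s hs
    simp only [Finset.mem_coe, Finset.mem_powersetCard] at hs
    exact Finset.erase_insert fun h => Finset.notMem_erase _ _ (hs.1 h)

lemma card_sigma_facetNeighbors :
    #((Finset.univ.filter fun s : Finset (Fin n) => 0 ∈ s).sigma facetNeighbors) =
      ∑ i ∈ Finset.Icc 1 n, i * Nat.choose (n - 1) (n - i) := by
  rw [Finset.card_sigma, ← Finset.sum_fiberwise_of_maps_to (t := Finset.Icc 1 n)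
    (g := fun s => #(facetNeighbors s))]
  · refine Finset.sum_congr rfl fun i hi => ?_
    rw [Finset.mem_Icc] at hi
    rw [Finset.sum_congr rfl fun s hs => (Finset.mem_filter.mp hs).2, Finset.sum_const,
      smul_eq_mul, mul_comm, Finset.filter_filter, card_filter_card_facetNeighbors hi.1 hi.2]
  · intro s hs
    have h0 := (Finset.mem_filter.mp hs).2
    have := Finset.card_pos.mpr ⟨_, h0⟩
    rw [card_facetNeighbors, Finset.card_compl, Fintype.card_fin, Finset.mem_Icc]
    have := Fin.pos (0 : Fin n)
    omega

end Corners

end AnLattice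

/-- for the `Aₙ` basis (Gram matrix `Jₙ + Iₙ`), the number of corners
`x ∈ C¹` with exactly `i` facet-neighbors in `C⁰` is `C(n−1, n−i)`, and the total number
of pairs `(x, x')`, `x ∈ C¹`, `x' ∈ T_f(x) ∩ C⁰` — the number of affine pieces of the
decision boundary function — is `Σ_{i=1}^{n} i·C(n−1, n−i)`. -/
theorem An_number_of_affine_pieces (n : ℕ) [NeZero n]
    (G : Matrix (Fin n) (Fin n) ℝ) (hG : IsUnit G.det)
    (hGram : G * G.transpose = Matrix.of (fun _ _ => (1 : ℝ)) + 1) :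
    (∀ i : ℕ, 1 ≤ i → i ≤ n →
      Set.ncard {x : Fin n → ℝ | x ∈ cornerSet G 1 ∧
          Set.ncard {x' : Fin n → ℝ | x' ∈ cornerSet G 0 ∧ sharesFacet G x x'} = i}
        = Nat.choose (n - 1) (n - i)) ∧
    Set.ncard {p : (Fin n → ℝ) × (Fin n → ℝ) |
        p.1 ∈ cornerSet G 1 ∧ p.2 ∈ cornerSet G 0 ∧ sharesFacet G p.1 p.2}
      = ∑ i ∈ Finset.Icc 1 n, i * Nat.choose (n - 1) (n - i) := by
  have hinj : Function.Injective fun s => latticeHom G (cornerVec s) :=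
    (latticeHom_injective hG).comp cornerVec_injective
  have hnbrs (s : Finset (Fin n)) (hs : 0 ∈ s) :
      {x' | x' ∈ cornerSet G 0 ∧ sharesFacet G (latticeHom G (cornerVec s)) x'} =
        (fun t => latticeHom G (cornerVec t)) '' (facetNeighbors s) := by
    rw [cornerSet_zero]
    ext x'
    constructor
    · rintro ⟨⟨t, ht, rfl⟩, h⟩
      exact ⟨t, (sharesFacet_cornerVec_iff hG hGram hs).mp ⟨ht, h⟩, rfl⟩
    · rintro ⟨t, ht, rfl⟩
      have h := (sharesFacet_cornerVec_iff hG hGram hs).mpr ht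
      exact ⟨⟨t, h.1, rfl⟩, h.2⟩
  constructor
  · intro i hi hin
    rw [← card_filter_card_facetNeighbors hi hin, ← Set.ncard_coe_finset,
      ← Set.ncard_image_of_injective _ hinj]
    congr 1
    ext x
    rw [cornerSet_one]
    constructor
    · rintro ⟨⟨s, hs, rfl⟩, h⟩
      rw [hnbrs s hs, Set.ncard_image_of_injective _ hinj, Set.ncard_coe_finset] at h
      exact ⟨s, by simpa using ⟨hs, h⟩, rfl⟩
    · rintro ⟨s, hs, rfl⟩
      simp only [Finset.coe_filter, Finset.mem_univ, true_and, Set.mem_ofPred_eq] at hs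
      refine ⟨⟨s, hs.1, rfl⟩, ?_⟩
      rw [hnbrs s hs.1, Set.ncard_image_of_injective _ hinj, Set.ncard_coe_finset, hs.2]
  · have hinj₂ : Function.Injective fun p : (_ : Finset (Fin n)) × Finset (Fin n) =>
        (latticeHom G (cornerVec p.1), latticeHom G (cornerVec p.2)) := by
      rintro ⟨s, t⟩ ⟨s', t'⟩ h
      obtain ⟨h₁, h₂⟩ := Prod.mk.inj h
      obtain rfl := hinj h₁
      obtain rfl := hinj h₂
      rfl
    rw [← card_sigma_facetNeighbors, ← Set.ncard_coe_finset,
      ← Set.ncard_image_of_injective _ hinj₂]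
    congr 1
    ext ⟨x, x'⟩
    constructor
    · rintro ⟨hx, hx'⟩
      simp only [cornerSet_one] at hx
      obtain ⟨s, hs, rfl⟩ := hx
      obtain ⟨t, ht, rfl⟩ := (hnbrs s hs).subset hx'
      exact ⟨⟨s, t⟩, by simpa using ⟨hs, ht⟩, rfl⟩
    · rintro ⟨⟨s, t⟩, hst, h⟩
      obtain ⟨rfl, rfl⟩ := Prod.mk.inj h
      simp only [Finset.mem_coe, Finset.mem_sigma, Finset.mem_filter, Finset.mem_univ,
        true_and] at hst
      refine ⟨?_, (hnbrs s hst.1).superset ⟨t, hst.2, rfl⟩⟩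
      rw [cornerSet_one]
      exact ⟨s, hst.1, rfl⟩
end
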